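/- arXiv:2110.00089 — 3 statements merged into one kernel-verified Lean document; each statement's English description precedes it below -/
import Mathlib

section
/- Let G₁, …, G_m be groups with generating sets S_i ⊆ G_i ∖ {1}, let G = G₁ ⋆ ⋯ ⋆ G_m be their free product, and let S = S₁ ∪ ⋯ ∪ S_m. Fix i ∈ {1,…,m} and a subset X ⊆ G_i with 1 ∈ X. Then L_{1,X} = {ε} ∪ ⋃_{s ∈ S∖S_i} {s·w : w ∈ L_{s^{−1}, {s^{−1}}}} ∪ ⋃_{s ∈ S_i∖X} {s·w : w ∈ L_{s^{−1}, s^{−1}X}}, and the sets appearing in this union are pairwise disjoint. -/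
/-- `Lang S g X` is the set of words over the alphabet `S` whose product is `g`
and all of whose nonempty proper prefixes have product avoiding `X`. -/
def Lang {G : Type*} [Group G] (S : Set G) (g : G) (X : Set G) : Set (List G) :=
  {w | (∀ a ∈ w, a ∈ S) ∧ w.prod = g ∧ ∀ k, 1 ≤ k → k < w.length → (w.take k).prod ∉ X}

namespace Monoid.CoprodI

/-- `StartsIn j g` says that the reduced word of `g` is nonempty and begins with a letter
from the factor `M j`. -/
def StartsIn {ι : Type*} {M : ι → Type*} [∀ i, Monoid (M i)] (j : ι) (g : CoprodI M) : Prop :=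
  ∃ w : Word M, w.prod = g ∧ w.fstIdx = some j

section Monoid

variable {ι : Type*} {M : ι → Type*} [∀ i, Monoid (M i)]

theorem Word.prod_injective : Function.Injective (Word.prod : Word M → CoprodI M) := by
  classical exact Word.equiv.symm.injective

theorem Word.fstIdx_empty_ne (j : ι) : (Word.empty : Word M).fstIdx ≠ some j := by
  simp [Word.fstIdx, Word.empty]

theorem startsIn_of {j : ι} {a : M j} (ha : a ≠ 1) : StartsIn j (of a) :=
  ⟨Word.cons a Word.empty (Word.fstIdx_empty_ne _) ha, by simp, by simp⟩

theorem StartsIn.ne_one {j : ι} {g : CoprodI M} (h : StartsIn j g) : g ≠ 1 := by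
  rintro rfl
  obtain ⟨w, hw, hj⟩ := h
  rw [← Word.prod_empty] at hw
  exact Word.fstIdx_empty_ne j (Word.prod_injective hw ▸ hj)

theorem StartsIn.unique {i j : ι} {g : CoprodI M} (hi : StartsIn i g) (hj : StartsIn j g) :
    i = j := by
  obtain ⟨w, hw, hi⟩ := hi
  obtain ⟨w', rfl, hj⟩ := hj
  rw [Word.prod_injective hw, hj] at hi
  exact (Option.some_injective _ hi).symm

theorem StartsIn.ne_of {i j : ι} {g : CoprodI M} (h : StartsIn j g) (hij : i ≠ j) (x : M i) :
    of x ≠ g := by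
  rintro rfl
  exact hij ((startsIn_of fun hx => h.ne_one (by simp [hx])).unique h)

theorem StartsIn.mul_of {j k : ι} {g : CoprodI M} (h : StartsIn j g) (t : M k) :
    g * of t = 1 ∨ StartsIn j (g * of t) := by
  obtain ⟨w, rfl, hj⟩ := h
  induction w using Word.consRecOn generalizing j with
  | empty => exact absurd hj (Word.fstIdx_empty_ne j)
  | cons i a w h1 h2 ih =>
    obtain rfl : i = j := by simpa using hj
    have prepend : ∀ w' : Word M, w'.prod = w.prod * of t → w'.fstIdx ≠ some i →
        StartsIn i ((Word.cons a w h1 h2).prod * of t) := fun w' hw' hi =>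
      ⟨Word.cons a w' hi h2, by simp [hw', mul_assoc], by simp⟩
    cases hw : w.fstIdx with
    | some l =>
      right
      rcases ih hw with h | ⟨w', hw', hl⟩
      · exact prepend Word.empty (by simp [h]) (Word.fstIdx_empty_ne _)
      · exact prepend w' hw' (by rwa [hl, ← hw])
    | none =>
      obtain rfl : w = Word.empty := Word.ext (by simpa [Word.fstIdx] using hw)
      by_cases hki : k = i
      · subst hki
        by_cases hat : a * t = 1
        · left
          simp [← map_mul, hat]
        · right
          simpa [← map_mul] using startsIn_of hat
      · right
        by_cases ht : t = 1
        · exact prepend Word.empty (by simp [ht]) (Word.fstIdx_empty_ne _)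
        · obtain ⟨w', hw', hk⟩ := startsIn_of ht
          exact prepend w' (by simp [hw']) (by simpa [hk] using hki)

theorem StartsIn.mul_prod {j : ι} {g : CoprodI M} (h : StartsIn j g) {v : List (CoprodI M)}
    (hv : ∀ a ∈ v, ∃ (k : ι) (t : M k), of t = a)
    (hne : ∀ n, 1 ≤ n → n ≤ v.length → g * (v.take n).prod ≠ 1) : StartsIn j (g * v.prod) := by
  induction v generalizing g with
  | nil => simpa using h
  | cons a v ih =>
    obtain ⟨k, t, rfl⟩ := hv _ List.mem_cons_self
    have h' : StartsIn j (g * of t) :=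
      (h.mul_of t).resolve_left (by simpa using hne 1 le_rfl (by simp))
    rw [List.prod_cons, ← mul_assoc]
    refine ih h' (fun a ha => hv a (List.mem_cons_of_mem _ ha)) fun n _ hn => ?_
    simpa [mul_assoc] using hne (n + 1) (by omega) (by simpa using hn)

end Monoid

end Monoid.CoprodI

theorem nil_mem_lang {G : Type*} [Group G] (S : Set G) (X : Set G) : [] ∈ Lang S 1 X := by
  simp [Lang]

theorem cons_mem_lang_iff {G : Type*} [Group G] {S : Set G} {X : Set G} {g s : G} {v : List G} :
    s :: v ∈ Lang S g X ↔
      s ∈ S ∧ (v ≠ [] → s ∉ X) ∧ v ∈ Lang S (s⁻¹ * g) ((fun a => s⁻¹ * a) '' X) := by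
  have hmem : ∀ h : G, h ∈ (fun a => s⁻¹ * a) '' X ↔ s * h ∈ X := fun h => by simp
  simp only [Lang, Set.mem_ofPred_eq, List.forall_mem_cons, List.prod_cons, hmem,
    eq_inv_mul_iff_mul_eq, List.length_cons]
  constructor
  · rintro ⟨⟨hs, hv⟩, hg, hX⟩
    refine ⟨hs, fun hne => ?_, hv, hg, fun k hk hkl => ?_⟩
    · simpa using hX 1 le_rfl (by simpa using List.length_pos_iff.2 hne)
    · simpa using hX (k + 1) (by omega) (by omega)
  · rintro ⟨hs, hne, hv, hg, hX⟩
    refine ⟨⟨hs, hv⟩, hg, fun k hk hkl => ?_⟩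
    obtain ⟨k, rfl⟩ := Nat.exists_eq_add_of_le' hk
    rcases Nat.eq_zero_or_pos k with rfl | hk0
    · simpa using hne (List.length_pos_iff.1 (by omega))
    · simpa using hX k hk0 (by omega)

open Monoid.CoprodI in
/-- A path in the free product leaving `1` by a letter of the factor `M j` can meet another
factor `M i` only after returning to `1`. -/
theorem Monoid.CoprodI.mem_lang_translate_iff {ι : Type*} {M : ι → Type*} [∀ i, Group (M i)]
    {S : Set (CoprodI M)} (hS : ∀ a ∈ S, ∃ (k : ι) (t : M k), of t = a)
    {i j : ι} (hij : i ≠ j) {X : Set (M i)} (hX : 1 ∈ X) {s : CoprodI M} (hs : StartsIn j s)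
    {g : CoprodI M} {v : List (CoprodI M)} :
    v ∈ Lang S g ((fun a => s⁻¹ * a) '' (of '' X)) ↔ v ∈ Lang S g {s⁻¹} := by
  have hmem : ∀ h : CoprodI M, h ∈ (fun a => s⁻¹ * a) '' (of '' X) ↔ s * h ∈ of '' X :=
    fun h => by rw [Set.image_mul_left, inv_inv, Set.mem_preimage]
  refine and_congr_right fun hv => and_congr_right fun _ => ⟨fun h k hk hkl hmem' => ?_,
    fun h k hk hkl hmem' => ?_⟩
  · refine h k hk hkl ((hmem _).2 ⟨1, hX, ?_⟩)
    rw [Set.mem_singleton_iff.1 hmem', map_one, mul_inv_cancel]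
  · obtain ⟨x, -, hx⟩ := (hmem _).1 hmem'
    refine (hs.mul_prod (v := v.take k) (fun a ha => hS a (hv a (List.mem_of_mem_take ha)))
      fun n hn hnk heq => ?_).ne_of hij x hx
    rw [List.length_take] at hnk
    rw [List.take_take, min_eq_left (by omega)] at heq
    exact h n hn (by omega) (eq_inv_of_mul_eq_one_right heq)

/-- In a free product `G = G₁ ⋆ ⋯ ⋆ G_m` with alphabet
`S = S₁ ∪ ⋯ ∪ S_m`, for `X ⊆ G_i` with `1 ∈ X`, we have
`L_{1,X} = {ε} ∪ ⋃_{s ∈ S∖S_i} s·L_{s⁻¹,{s⁻¹}} ∪ ⋃_{s ∈ S_i∖X} s·L_{s⁻¹, s⁻¹X}`,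
and the sets appearing in this union are pairwise disjoint. -/
theorem lang_one_first_letter_decomposition {m : ℕ} (Gi : Fin m → Type*) [∀ i, Group (Gi i)]
    (Si : ∀ i, Set (Gi i)) (hS1 : ∀ i, (1 : Gi i) ∉ Si i)
    (hgen : ∀ i, Subgroup.closure (Si i) = ⊤)
    (S : Set (Monoid.CoprodI Gi))
    (hS : S = ⋃ j, Monoid.CoprodI.of '' Si j)
    (i : Fin m) (X : Set (Gi i)) (hX : (1 : Gi i) ∈ X)
    (prepOther : Monoid.CoprodI Gi → Set (List (Monoid.CoprodI Gi)))
    (hprepOther : ∀ s : Monoid.CoprodI Gi,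
      prepOther s = (fun w => s :: w) '' Lang S s⁻¹ {s⁻¹})
    (prepOwn : Gi i → Set (List (Monoid.CoprodI Gi)))
    (hprepOwn : ∀ s : Gi i, prepOwn s
      = (fun w => Monoid.CoprodI.of s :: w) ''
          Lang S (Monoid.CoprodI.of s⁻¹) (Monoid.CoprodI.of '' ((fun a => s⁻¹ * a) '' X))) :
    (Lang S 1 (Monoid.CoprodI.of '' X)
        = {([] : List (Monoid.CoprodI Gi))}
            ∪ (⋃ s ∈ S \ (Monoid.CoprodI.of '' Si i), prepOther s)
            ∪ (⋃ s ∈ Si i \ X, prepOwn s))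
      ∧ (∀ s ∈ S \ (Monoid.CoprodI.of '' Si i),
          Disjoint {([] : List (Monoid.CoprodI Gi))} (prepOther s))
      ∧ (∀ s ∈ Si i \ X, Disjoint {([] : List (Monoid.CoprodI Gi))} (prepOwn s))
      ∧ (∀ s ∈ S \ (Monoid.CoprodI.of '' Si i), ∀ t ∈ S \ (Monoid.CoprodI.of '' Si i),
          s ≠ t → Disjoint (prepOther s) (prepOther t))
      ∧ (∀ s ∈ Si i \ X, ∀ t ∈ Si i \ X, s ≠ t → Disjoint (prepOwn s) (prepOwn t))
      ∧ (∀ s ∈ S \ (Monoid.CoprodI.of '' Si i), ∀ t ∈ Si i \ X,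
          Disjoint (prepOther s) (prepOwn t)) := by
  have hof : ∀ a ∈ S, ∃ (k : Fin m) (t : Gi k), Monoid.CoprodI.of t = a := by
    intro a ha
    rw [hS] at ha
    obtain ⟨k, t, -, rfl⟩ := Set.mem_iUnion.1 ha
    exact ⟨k, t, rfl⟩
  have hother : ∀ s ∈ S \ (Monoid.CoprodI.of '' Si i), ∃ j, i ≠ j ∧
      Monoid.CoprodI.StartsIn j s := by
    rintro s ⟨hs, hsi⟩
    rw [hS] at hs
    obtain ⟨j, t, ht, rfl⟩ := Set.mem_iUnion.1 hs
    refine ⟨j, ?_, Monoid.CoprodI.startsIn_of fun h => hS1 j (h ▸ ht)⟩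
    rintro rfl
    exact hsi ⟨t, ht, rfl⟩
  have htranslate : ∀ s : Gi i, (fun a => (Monoid.CoprodI.of s)⁻¹ * a) ''
      ((Monoid.CoprodI.of : Gi i →* Monoid.CoprodI Gi) '' X) =
      Monoid.CoprodI.of '' ((fun a => s⁻¹ * a) '' X) := fun s => by
    simp only [Set.image_image, map_mul, map_inv]
  obtain rfl : prepOther = _ := funext hprepOther
  obtain rfl : prepOwn = _ := funext hprepOwn
  refine ⟨?_, ?_, ?_, ?_, ?_, ?_⟩
  · ext w
    simp only [Set.mem_union, Set.mem_singleton_iff, Set.mem_iUnion, exists_prop]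
    constructor
    · intro hw
      rcases w with _ | ⟨s, v⟩
      · exact Or.inl (Or.inl rfl)
      · obtain ⟨hs, hsX, hv⟩ := cons_mem_lang_iff.1 hw
        rw [mul_one] at hv
        by_cases hsi : s ∈ Monoid.CoprodI.of '' Si i
        · obtain ⟨t, ht, rfl⟩ := hsi
          refine Or.inr ⟨t, ⟨ht, fun htX => hsX ?_ ⟨t, htX, rfl⟩⟩, v, ?_, rfl⟩
          · rintro rfl
            have h1 : Monoid.CoprodI.of t = (1 : Monoid.CoprodI Gi) := by simpa using hv.2.1.symm
            rw [← map_one (Monoid.CoprodI.of : Gi i →* _)] at h1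
            exact hS1 i (Monoid.CoprodI.of_injective i h1 ▸ ht)
          · rwa [← htranslate, map_inv]
        · obtain ⟨j, hij, hj⟩ := hother s ⟨hs, hsi⟩
          exact Or.inl (Or.inr ⟨s, ⟨hs, hsi⟩, v,
            (Monoid.CoprodI.mem_lang_translate_iff hof hij hX hj).1 hv, rfl⟩)
    · rintro ((rfl | ⟨s, hs, v, hv, rfl⟩) | ⟨t, ⟨ht, htX⟩, v, hv, rfl⟩)
      · exact nil_mem_lang _ _
      · obtain ⟨j, hij, hj⟩ := hother s hs
        refine cons_mem_lang_iff.2 ⟨hs.1, fun _ => ?_, ?_⟩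
        · rintro ⟨x, -, hx⟩
          exact hj.ne_of hij x hx
        · rw [mul_one]
          exact (Monoid.CoprodI.mem_lang_translate_iff hof hij hX hj).2 hv
      · refine cons_mem_lang_iff.2 ⟨?_, fun _ => ?_, ?_⟩
        · rw [hS]
          exact Set.mem_iUnion.2 ⟨i, t, ht, rfl⟩
        · rwa [(Monoid.CoprodI.of_injective i).mem_set_image]
        · rwa [mul_one, htranslate, ← map_inv]
  · rintro s -
    simp
  · rintro s -
    simp
  · rintro s - t - hst
    rw [Set.disjoint_left]
    rintro _ ⟨v, -, rfl⟩ ⟨w, -, h⟩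
    exact hst (List.cons.inj h).1.symm
  · rintro s - t - hst
    rw [Set.disjoint_left]
    rintro _ ⟨v, -, rfl⟩ ⟨w, -, h⟩
    exact hst (Monoid.CoprodI.of_injective i (List.cons.inj h).1.symm)
  · rintro s ⟨-, hs⟩ t ⟨ht, -⟩
    rw [Set.disjoint_left]
    rintro _ ⟨v, -, rfl⟩ ⟨w, -, h⟩
    exact hs ⟨t, ht, (List.cons.inj h).1⟩
end

section
/- Let d, m ≥ 2 be integers, let G = (ℤ/dℤ)^{⋆m} be the free product of m copies of the cyclic group of order d with x₁, …, x_m the fixed generators of the factors, and let S = {x₁,…,x_m}. Then the map (w₁, w₂, …, w_{d−1}) ↦ w₁·x₁·w₂·x₁·⋯·w_{d−1}·x₁ (concatenating the words w_j with single letters x₁ interleaved, ending with x₁) is a bijection from (L_{1,{x₁}})^{d−1} onto L_{x₁^{−1}, {x₁^{−1}}}: every word over S equal to x₁^{−1} in G with no nonempty proper prefix equal to x₁^{−1} decomposes uniquely in this form with each w_j a word over S equal to 1 with no nonempty proper prefix equal to x₁. -/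
section Decomposition

variable {G : Type*} [Group G] {S : Set G} {g x : G}

theorem mem_Lang_singleton_iff {w : List G} :
    w ∈ Lang S g {x} ↔ (∀ a ∈ w, a ∈ S) ∧ w.prod = g ∧
      ∀ u v, w = u ++ v → u ≠ [] → v ≠ [] → u.prod ≠ x := by
  refine and_congr_right fun _ => and_congr_right fun _ => ⟨?_, ?_⟩
  · rintro h u v rfl hu hv
    have h₁ := List.length_pos_iff.2 hu
    have h₂ := List.length_pos_iff.2 hv
    simpa using h u.length h₁ (by simp [h₂])
  · intro h k hk hkw
    refine h _ _ (List.take_append_drop k w).symm ?_ ?_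
    · rw [← List.length_pos_iff, List.length_take]
      omega
    · rw [← List.length_pos_iff, List.length_drop]
      omega

/-- The words over `S` with product `g` none of whose proper prefixes, the empty one included,
has product `g`. -/
def FirstHit (S : Set G) (g : G) : Set (List G) :=
  {w | (∀ a ∈ w, a ∈ S) ∧ w.prod = g ∧ ∀ u v, w = u ++ v → v ≠ [] → u.prod ≠ g}

theorem FirstHit_one : FirstHit S (1 : G) = {[]} := by
  ext w
  constructor
  · rintro ⟨-, -, h⟩
    by_contra hw
    exact h [] w rfl hw rfl
  · rintro rfl
    refine ⟨by simp, rfl, fun u v h hv => ?_⟩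
    exact absurd (List.append_eq_nil_iff.1 h.symm).2 hv

theorem FirstHit_eq_Lang (hg : g ≠ 1) : FirstHit S g = Lang S g {g} := by
  ext w
  rw [mem_Lang_singleton_iff]
  refine and_congr_right fun _ => and_congr_right fun _ => ⟨fun h u v hw _ => h u v hw, ?_⟩
  intro h u v hw hv
  rcases eq_or_ne u [] with rfl | hu
  · simpa using hg.symm
  · exact h u v hw hu hv

/-- The Cayley graph of `G` with respect to `S` leaves `Z` only along the edge from `1` to `x`. -/
def ExitsOnlyAt (S : Set G) (x : G) (Z : Set G) : Prop :=
  ∀ g ∈ Z, ∀ s ∈ S, g * s ∉ Z → g = 1 ∧ s = x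

variable {Z : Set G}

theorem ExitsOnlyAt.prefix_prod_mem (hZ : ExitsOnlyAt S x Z) (h1 : 1 ∈ Z) {u v : List G}
    (h : u ++ v ∈ Lang S 1 {x}) : u.prod ∈ Z := by
  rw [mem_Lang_singleton_iff] at h
  obtain ⟨hS, hprod, havoid⟩ := h
  induction u using List.reverseRecOn generalizing v with
  | nil => simpa using h1
  | append_singleton u s ih =>
    by_contra hn
    have hu : u.prod ∈ Z := ih (v := s :: v) (by simpa using hS) (by simpa using hprod)
      (by simpa using havoid)
    obtain ⟨hu1, rfl⟩ := hZ _ hu s (hS s (by simp)) (by simpa using hn)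
    rcases eq_or_ne v [] with rfl | hv
    · rw [List.append_nil] at hprod
      exact hn (hprod ▸ h1)
    · exact havoid _ v rfl (by simp) hv (by simp [hu1])

theorem ExitsOnlyAt.exists_eq_append (hZ : ExitsOnlyAt S x Z) (h1 : 1 ∈ Z) (hx : x ∉ Z)
    {v : List G} (hS : ∀ a ∈ v, a ∈ S) (hv : v.prod ∉ Z) :
    ∃ w ∈ Lang S 1 {x}, ∃ u, v = w ++ x :: u := by
  induction hn : v.length using Nat.strong_induction_on generalizing v with
  | _ n ih =>
    by_cases h : ∃ p q, v = p ++ q ∧ q ≠ [] ∧ p.prod ∉ Z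
    · obtain ⟨p, q, rfl, hq, hp⟩ := h
      have hq' := List.length_pos_iff.2 hq
      obtain ⟨w, hw, u, rfl⟩ := ih p.length (by rw [← hn, List.length_append]; omega)
        (fun a ha => hS a (List.mem_append_left q ha)) hp rfl
      exact ⟨w, hw, u ++ q, by simp⟩
    · push Not at h
      rcases List.eq_nil_or_concat' v with rfl | ⟨w, s, rfl⟩
      · exact absurd h1 (by simpa using hv)
      · obtain ⟨hw, rfl⟩ := hZ _ (h w [s] rfl (by simp)) s (hS s (by simp)) (by simpa using hv)
        refine ⟨w, mem_Lang_singleton_iff.2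
          ⟨fun a ha => hS a (List.mem_append_left _ ha), hw, ?_⟩, [], rfl⟩
        rintro p q rfl - - hp
        exact hx (hp ▸ h p (q ++ [s]) (by simp) (by simp))

theorem Lang_append_cons_inj (hx : x ≠ 1) {w w' u u' : List G} (hw : w ∈ Lang S 1 {x})
    (hw' : w' ∈ Lang S 1 {x}) (h : w ++ x :: u = w' ++ x :: u') : w = w' ∧ u = u' := by
  have key : ∀ {w w' t : List G}, w ∈ Lang S 1 {x} → w' ∈ Lang S 1 {x} →
      w' ≠ w ++ x :: t := by
    rintro w w' t hw hw' rfl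
    rw [mem_Lang_singleton_iff] at hw hw'
    have hp : (w ++ [x]).prod = x := by simp [hw.2.1]
    rcases eq_or_ne t [] with rfl | ht
    · exact hx (hp.symm.trans hw'.2.1)
    · exact hw'.2.2 (w ++ [x]) t (by simp) (by simp) ht hp
  rcases List.append_eq_append_iff.1 h with ⟨t, h₁, h₂⟩ | ⟨t, h₁, h₂⟩
  · cases t with
    | nil => simp_all
    | cons a t =>
      obtain ⟨rfl, -⟩ := List.cons.inj h₂
      exact absurd h₁ (key hw hw')
  · cases t with
    | nil => simp_all
    | cons a t =>
      obtain ⟨rfl, -⟩ := List.cons.inj h₂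
      exact absurd h₁ (key hw' hw)

theorem ExitsOnlyAt.append_cons_mem_FirstHit_iff (hZ : ExitsOnlyAt S x Z) (h1 : 1 ∈ Z)
    (hxS : x ∈ S) {n : ℕ} (hn : x ^ (n + 1) ∉ Z) {w u : List G} (hw : w ∈ Lang S 1 {x}) :
    w ++ x :: u ∈ FirstHit S (x ^ (n + 1)) ↔ u ∈ FirstHit S (x ^ n) := by
  have hw1 := hw.2.1
  constructor
  · rintro ⟨hS, hprod, havoid⟩
    refine ⟨fun a ha => hS a (by simp [ha]), ?_, ?_⟩
    · simpa [hw1, pow_succ'] using hprod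
    · rintro p q rfl hq hp
      exact havoid (w ++ x :: p) q (by simp) hq (by simp [hw1, hp, pow_succ'])
  · rintro ⟨hS, hprod, havoid⟩
    refine ⟨?_, by simp [hw1, hprod, pow_succ'], ?_⟩
    · intro a ha
      rcases List.mem_append.1 ha with ha | ha
      · exact hw.1 a ha
      · rcases List.mem_cons.1 ha with rfl | ha
        exacts [hxS, hS a ha]
    · intro p q h hq hp
      rcases List.append_eq_append_iff.1 h with ⟨t, rfl, h₂⟩ | ⟨t, rfl, -⟩
      · cases t with
        | nil =>
          rw [List.append_nil, hw1] at hp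
          exact hn (hp ▸ h1)
        | cons a t =>
          obtain ⟨rfl, rfl⟩ := List.cons.inj h₂
          refine havoid t q rfl hq ?_
          simpa [hw1, pow_succ'] using hp
      · exact hn (hp ▸ hZ.prefix_prod_mem h1 hw)

theorem ExitsOnlyAt.bijOn_FirstHit (hZ : ExitsOnlyAt S x Z) (h1 : 1 ∈ Z) (hxS : x ∈ S) (n : ℕ)
    (hn : ∀ k, 1 ≤ k → k ≤ n → x ^ k ∉ Z) :
    Set.BijOn (fun w : Fin n → List G => (List.ofFn fun j => w j ++ [x]).flatten)
      {w | ∀ j, w j ∈ Lang S 1 {x}} (FirstHit S (x ^ n)) := by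
  induction n with
  | zero =>
    rw [pow_zero, FirstHit_one]
    refine ⟨fun w _ => by simp, fun w _ w' _ _ => Subsingleton.elim w w', ?_⟩
    rintro _ rfl
    exact ⟨Fin.elim0, fun j => j.elim0, by simp⟩
  | succ n ih =>
    have hxZ : x ∉ Z := by simpa using hn 1 le_rfl (by omega)
    have hx : x ≠ 1 := fun h => hxZ (h ▸ h1)
    have hn1 := hn (n + 1) (by omega) le_rfl
    obtain ⟨hmaps, hinj, hsurj⟩ := ih fun k hk hkn => hn k hk (by omega)
    have hcons : ∀ w : Fin (n + 1) → List G, (List.ofFn fun j => w j ++ [x]).flatten =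
        w 0 ++ x :: (List.ofFn fun j => Fin.tail w j ++ [x]).flatten := by
      intro w
      simp [List.ofFn_succ, Fin.tail]
    refine ⟨?_, ?_, ?_⟩
    · intro w hw
      simp only [hcons]
      exact (hZ.append_cons_mem_FirstHit_iff h1 hxS hn1 (hw 0)).2 (hmaps fun j => hw j.succ)
    · intro w hw w' hw' h
      simp only [hcons] at h
      obtain ⟨h₀, ht⟩ := Lang_append_cons_inj hx (hw 0) (hw' 0) h
      have htail : Fin.tail w = Fin.tail w' := hinj (fun j => hw j.succ) (fun j => hw' j.succ) ht
      rw [← Fin.cons_self_tail w, ← Fin.cons_self_tail w', h₀, htail]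
    · intro v hv
      obtain ⟨w₀, hw₀, u, rfl⟩ := hZ.exists_eq_append h1 hxZ hv.1 (hv.2.1 ▸ hn1)
      obtain ⟨w, hw, rfl⟩ :=
        hsurj ((hZ.append_cons_mem_FirstHit_iff h1 hxS hn1 hw₀).1 hv)
      refine ⟨Fin.cons w₀ w, Fin.cases hw₀ hw, ?_⟩
      simp only [hcons, Fin.cons_zero, Fin.tail_cons]

end Decomposition

namespace Monoid.CoprodI

variable {ι : Type*} {M : ι → Type*} [∀ i, Group (M i)] [∀ i, DecidableEq (M i)]

namespace Word

theorem getLast?_rcons {i : ι} (p : Pair M i) (hp : p.tail.toList ≠ []) :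
    (rcons p).toList.getLast? = p.tail.toList.getLast? := by
  unfold rcons
  split_ifs with h
  · rfl
  · obtain ⟨a, l, hl⟩ := List.exists_cons_of_ne_nil hp
    simp [cons, hl]

theorem toList_rcons_of_tail_eq_nil {i : ι} (p : Pair M i) (hp : p.tail.toList = []) :
    (rcons p).toList = if p.head = 1 then [] else [⟨i, p.head⟩] := by
  unfold rcons
  split_ifs with h
  · exact hp
  · simp [cons, hp]

end Word

variable [DecidableEq ι]

/-- The elements whose inverse has a reduced word not ending in a letter of the factor `i`, that
is, whose own reduced word does not start with such a letter. -/
def notStartingIn (M : ι → Type*) [∀ i, Group (M i)] [∀ i, DecidableEq (M i)] (i : ι) :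
    Set (CoprodI M) :=
  {g | ∀ a ∈ (Word.equiv g⁻¹).toList.getLast?, a.1 ≠ i}

theorem one_mem_notStartingIn (i : ι) : 1 ∈ notStartingIn M i := by
  simp [notStartingIn, Word.equiv]

theorem of_notMem_notStartingIn {i : ι} {m : M i} (hm : m ≠ 1) :
    of m ∉ notStartingIn M i := by
  have h : (Word.equiv (of m : CoprodI M)⁻¹).toList = [⟨i, m⁻¹⟩] := by
    rw [← map_inv]
    change (of m⁻¹ • (Word.empty : Word M)).toList = _
    rw [← Word.cons_eq_smul (h1 := by simp [Word.fstIdx]) (h2 := by simpa using hm)]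
    rfl
  simp [notStartingIn, h]

theorem eq_one_of_mul_of_notMem {i j : ι} {g : CoprodI M} {m : M j}
    (hg : g ∈ notStartingIn M i) (hgm : g * of m ∉ notStartingIn M i) : g = 1 ∧ j = i := by
  set w := Word.equiv g⁻¹
  have hmul : Word.equiv (g * of m)⁻¹ = of m⁻¹ • w := by
    rw [mul_inv_rev, ← map_inv]
    exact mul_smul (of m⁻¹) g⁻¹ (Word.empty : Word M)
  set p := Word.equivPair j w with hp
  have hwp : w = Word.rcons p := by rw [hp, ← Word.equivPair_symm, Equiv.symm_apply_apply]
  change ∀ a ∈ w.toList.getLast?, a.1 ≠ i at hg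
  change ¬ ∀ a ∈ (Word.equiv (g * of m)⁻¹).toList.getLast?, a.1 ≠ i at hgm
  obtain ⟨q, hq, hqt⟩ : ∃ q : Word.Pair M j, of m⁻¹ • w = Word.rcons q ∧ q.tail = p.tail :=
    ⟨_, Word.of_smul_def j w m⁻¹, rfl⟩
  rw [hmul, hq] at hgm
  by_cases ht : p.tail.toList = []
  · rw [Word.toList_rcons_of_tail_eq_nil _ (hqt ▸ ht)] at hgm
    have hj : j = i := by
      by_contra hne
      apply hgm
      split_ifs <;> simp [hne]
    refine ⟨?_, hj⟩
    rw [hwp, Word.toList_rcons_of_tail_eq_nil _ ht] at hg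
    have hnil : w.toList = [] := by
      rw [hwp, Word.toList_rcons_of_tail_eq_nil _ ht]
      split_ifs at hg ⊢ with h
      · rfl
      · simp [hj] at hg
    have hprod : Word.prod w = g⁻¹ := Word.equiv.symm_apply_apply _
    rw [Word.prod, hnil] at hprod
    simpa using hprod.symm
  · rw [Word.getLast?_rcons _ (hqt ▸ ht), hqt] at hgm
    rw [hwp, Word.getLast?_rcons _ ht] at hg
    exact absurd hg hgm

end Monoid.CoprodI

/-- Let `d, m ≥ 2` and `G = (ℤ/dℤ)^{⋆m}` with `S = {x₁,…,x_m}`.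
The map `(w₁,…,w_{d−1}) ↦ w₁·x₁·w₂·x₁⋯w_{d−1}·x₁` is a bijection from
`(L_{1,{x₁}})^{d−1}` onto `L_{x₁⁻¹,{x₁⁻¹}}`. -/
theorem lang_xinv_decomposition (d m : ℕ) (hd : 2 ≤ d) (hm : 2 ≤ m)
    (x : Fin m → Monoid.CoprodI (fun _ : Fin m => Multiplicative (ZMod d)))
    (hx : ∀ i, x i = Monoid.CoprodI.of (i := i) (Multiplicative.ofAdd (1 : ZMod d)))
    (x₁ : Monoid.CoprodI (fun _ : Fin m => Multiplicative (ZMod d)))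
    (hx₁ : x₁ = x ⟨0, by omega⟩) :
    Set.BijOn
      (fun w : Fin (d - 1) → List (Monoid.CoprodI (fun _ : Fin m => Multiplicative (ZMod d))) =>
        (List.ofFn fun j => w j ++ [x₁]).flatten)
      {w | ∀ j, w j ∈ Lang (Set.range x) 1 {x₁}}
      (Lang (Set.range x) x₁⁻¹ {x₁⁻¹}) := by
  subst hx₁
  set i₀ : Fin m := ⟨0, by omega⟩
  set Z := Monoid.CoprodI.notStartingIn (fun _ : Fin m => Multiplicative (ZMod d)) i₀
  have hZ : ExitsOnlyAt (Set.range x) (x i₀) Z := by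
    rintro g hg _ ⟨j, rfl⟩ hgs
    rw [hx j] at hgs
    obtain ⟨h1, rfl⟩ := Monoid.CoprodI.eq_one_of_mul_of_notMem hg hgs
    exact ⟨h1, rfl⟩
  have hpow : ∀ k : ℕ, x i₀ ^ k =
      Monoid.CoprodI.of (i := i₀) (Multiplicative.ofAdd (k : ZMod d)) := by
    intro k
    rw [hx, ← map_pow, ← ofAdd_nsmul, nsmul_one]
  have hpowZ : ∀ k, 1 ≤ k → k ≤ d - 1 → x i₀ ^ k ∉ Z := by
    intro k hk hkd
    rw [hpow]
    refine Monoid.CoprodI.of_notMem_notStartingIn fun h => ?_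
    rw [ofAdd_eq_one, ZMod.natCast_eq_zero_iff] at h
    have := Nat.le_of_dvd (by omega) h
    omega
  have h1 : (1 : Monoid.CoprodI fun _ : Fin m => Multiplicative (ZMod d)) ∈ Z :=
    Monoid.CoprodI.one_mem_notStartingIn i₀
  have hinv : x i₀ ^ (d - 1) = (x i₀)⁻¹ := by
    rw [eq_inv_iff_mul_eq_one, ← pow_succ, Nat.sub_add_cancel (by omega), hpow,
      ZMod.natCast_self, ofAdd_zero, map_one]
  have hne : (x i₀)⁻¹ ≠ 1 := fun h => hpowZ (d - 1) (by omega) le_rfl (by rwa [hinv, h])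
  rw [← FirstHit_eq_Lang hne, ← hinv]
  exact hZ.bijOn_FirstHit h1 ⟨i₀, rfl⟩ (d - 1) hpowZ
end

section
/- Let G = ⟨x | x² = 1⟩ ⋆ ⟨y | y³ = 1⟩ ≅ ℤ/2ℤ ⋆ ℤ/3ℤ (isomorphic to PSL₂(ℤ)) and let S = {x, y}. Then the cogrowth series F = F_{G;S}(t) ∈ ℚ[[t]] satisfies the polynomial equation ((t−1)³ + t³)·((t+1)³ − t³)·F³ + (t⁵ − t⁴ + t³ + 2t² − 1)·F² + (t³ − t² + 1)·F + 1 = 0 as formal power series. -/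
/-- `CL S n` is the number of words of length `n` over the alphabet `S` whose
product equals the identity of the group. -/
noncomputable def CL {G : Type*} [Group G] (S : Set G) (n : ℕ) : ℕ :=
  Nat.card {w : Fin n → G // (∀ i, w i ∈ S) ∧ (List.ofFn w).prod = 1}

/-- The cogrowth series `F_{G;S}(t) = ∑ CL(n;G,S) tⁿ ∈ ℚ[[t]]`. -/
noncomputable def cogrowthSeries {G : Type*} [Group G] (S : Set G) : PowerSeries ℚ :=
  PowerSeries.mk fun n => (CL S n : ℚ)

/-- Reduced words of `ℤ/2 ⋆ ℤ/3` that do not start with `x`: the empty word, `y ^ ±1`, and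
`y ^ ±1 * x` followed by such a word. The sign `+` is encoded by `false`. -/
inductive ReducedTail
  | nil
  | y (ε : Bool)
  | yx (ε : Bool) (r : ReducedTail)

namespace ReducedTail

/-- A reduced word of `ℤ/2 ⋆ ℤ/3`: an optional leading `x`, and a tail. -/
abbrev Reduced := Bool × ReducedTail

/-- Left multiplication by `x` on reduced words. -/
def mulX : Reduced → Reduced
  | (e, r) => (!e, r)

/-- Left multiplication by `y` on reduced words. -/
def mulY : Reduced → Reduced
  | (true, r) => (false, yx false r)
  | (false, nil) => (false, y false)
  | (false, y false) => (false, y true)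
  | (false, y true) => (false, nil)
  | (false, yx false r) => (false, yx true r)
  | (false, yx true r) => (true, r)

theorem mulX_mulX (w : Reduced) : mulX (mulX w) = w := by
  rcases w with ⟨_ | _, r⟩ <;> rfl

theorem mulY_mulY_mulY (w : Reduced) : mulY (mulY (mulY w)) = w := by
  rcases w with ⟨_ | _, _ | ⟨_ | _⟩ | ⟨_ | _, r⟩⟩ <;> rfl

/-- Left multiplication by `x` as a permutation. -/
def permX : Equiv.Perm Reduced := ⟨mulX, mulX, mulX_mulX, mulX_mulX⟩

/-- Left multiplication by `y` as a permutation. -/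
def permY : Equiv.Perm Reduced :=
  ⟨mulY, fun w => mulY (mulY w), mulY_mulY_mulY, mulY_mulY_mulY⟩

section Eval

variable {G : Type*} [Group G]

/-- The value of a tail at `x = p`, `y = q`. -/
def evalTail (p q : G) : ReducedTail → G
  | nil => 1
  | y ε => cond ε (q * q) q
  | yx ε r => cond ε (q * q) q * p * evalTail p q r

/-- The value of a reduced word at `x = p`, `y = q`. -/
def eval (p q : G) (w : Reduced) : G := cond w.1 p 1 * evalTail p q w.2

theorem eval_mulX {p : G} (hp : p * p = 1) (q : G) (w : Reduced) :
    eval p q (mulX w) = p * eval p q w := by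
  rcases w with ⟨_ | _, r⟩ <;> simp [mulX, eval, ← mul_assoc, hp]

theorem eval_mulY (p : G) {q : G} (hq : q * q * q = 1) (w : Reduced) :
    eval p q (mulY w) = q * eval p q w := by
  rcases w with ⟨_ | _, _ | ⟨_ | _⟩ | ⟨_ | _, r⟩⟩ <;>
    simp [mulY, eval, evalTail, ← mul_assoc, hq]

end Eval

section Weight

variable {R : Type*} [CommRing R]

/-- The weight of a tail, multiplicative in the syllables `x`, `y`, `y⁻¹`. -/
def weightTail (a b c : R) : ReducedTail → R
  | nil => 1
  | y ε => cond ε c b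
  | yx ε r => cond ε c b * a * weightTail a b c r

/-- The weight of a reduced word, multiplicative in the syllables `x`, `y`, `y⁻¹`. -/
def weight (a b c : R) (w : Reduced) : R := cond w.1 a 1 * weightTail a b c w.2

theorem weight_eq {t a b c : R} (ha : a = t * (1 + c * a)) (hb : b = t * (1 + a * b))
    (hc : c = t * (b + a * c)) {w : Reduced} (hw : w ≠ (false, nil)) :
    weight a b c w = t * (weight a b c (mulX w) + weight a b c (mulY (mulY w))) := by
  rcases w with ⟨_ | _, _ | ⟨_ | _⟩ | ⟨_ | _, r⟩⟩
  · exact absurd rfl hw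
  all_goals simp only [weight, weightTail, mulX, mulY, cond_true, cond_false, Bool.not_true,
    Bool.not_false]
  · linear_combination hb
  · linear_combination hc
  · linear_combination a * weightTail a b c r * hb
  · linear_combination a * weightTail a b c r * hc
  · linear_combination ha
  · linear_combination b * ha
  · linear_combination c * ha
  · linear_combination b * a * weightTail a b c r * ha
  · linear_combination c * a * weightTail a b c r * ha

end Weight

end ReducedTail

/-- The homomorphism out of `ℤ/n` determined by an element of order dividing `n`. -/
theorem exists_monoidHom_multiplicative_zmod {H : Type*} [Group H] (n : ℕ) (h : H)
    (hn : h ^ n = 1) :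
    ∃ f : Multiplicative (ZMod n) →* H, f (Multiplicative.ofAdd 1) = h := by
  let f : {f : ℤ →+ Additive H // f n = 0} := ⟨zmultiplesHom (Additive H) (Additive.ofMul h), by
    simpa [← ofMul_pow] using congrArg Additive.ofMul hn⟩
  refine ⟨AddMonoidHom.toMultiplicativeLeft (ZMod.lift n f), ?_⟩
  simpa [f] using congrArg Additive.toMul (ZMod.lift_coe n f 1)

section FreeProduct

open ReducedTail Monoid.Coprod

/-- Elements of `ℤ/2 ⋆ ℤ/3` have normal forms on which multiplication by the generators acts
by `mulX` and `mulY`. -/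
theorem exists_normalForm (x y : Monoid.Coprod (Multiplicative (ZMod 2)) (Multiplicative (ZMod 3)))
    (hx : x = inl (Multiplicative.ofAdd (1 : ZMod 2)))
    (hy : y = inr (Multiplicative.ofAdd (1 : ZMod 3))) :
    ∃ nf : Monoid.Coprod (Multiplicative (ZMod 2)) (Multiplicative (ZMod 3)) → Reduced,
      (∀ g, nf (x⁻¹ * g) = mulX (nf g)) ∧ (∀ g, nf (y⁻¹ * g) = mulY (mulY (nf g))) ∧
      ∀ g, nf g = (false, nil) ↔ g = 1 := by
  obtain ⟨f₂, hf₂⟩ := exists_monoidHom_multiplicative_zmod 2 permX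
    (Equiv.ext fun w => mulX_mulX w)
  obtain ⟨f₃, hf₃⟩ := exists_monoidHom_multiplicative_zmod 3 permY
    (Equiv.ext fun w => mulY_mulY_mulY w)
  have hxx : x * x = 1 := by
    rw [hx, ← map_mul, show (Multiplicative.ofAdd (1 : ZMod 2)) * Multiplicative.ofAdd 1 = 1 by
      decide, map_one]
  have hyy : y * y * y = 1 := by
    rw [hy, ← map_mul, ← map_mul, show (Multiplicative.ofAdd (1 : ZMod 3)) *
      Multiplicative.ofAdd 1 * Multiplicative.ofAdd 1 = 1 by decide, map_one]
  let φ := lift f₂ f₃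
  have hφx : φ x = permX := by rw [hx, lift_apply_inl, hf₂]
  have hφy : φ y = permY := by rw [hy, lift_apply_inr, hf₃]
  let M : Submonoid (Monoid.Coprod (Multiplicative (ZMod 2)) (Multiplicative (ZMod 3))) :=
    { carrier := {g | ∀ w, eval x y (φ g w) = g * eval x y w}
      one_mem' := fun w => by simp
      mul_mem' := fun {g h} hg hh w => by
        rw [map_mul, Equiv.Perm.mul_apply, hg, hh, mul_assoc] }
  have hxM : x ∈ M := fun w => by rw [hφx]; exact eval_mulX hxx y w
  have hyM : y ∈ M := fun w => by rw [hφy]; exact eval_mulY x hyy w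
  have hM : ∀ g, g ∈ M := fun g => by
    induction g using Monoid.Coprod.induction_on with
    | inl m =>
      rw [show m = Multiplicative.ofAdd 1 ^ m.toAdd.val by revert m; decide, map_pow, ← hx]
      exact pow_mem hxM _
    | inr m =>
      rw [show m = Multiplicative.ofAdd 1 ^ m.toAdd.val by revert m; decide, map_pow, ← hy]
      exact pow_mem hyM _
    | mul g h hg hh => exact mul_mem hg hh
  refine ⟨fun g => φ g (false, nil), fun g => ?_, fun g => ?_, fun g => ⟨fun h => ?_, fun h => ?_⟩⟩
  · simp only [map_mul, map_inv, hφx]; rfl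
  · simp only [map_mul, map_inv, hφy]; rfl
  · have := hM g (false, nil)
    rw [show φ g (false, nil) = (false, nil) from h] at this
    simpa [eval, evalTail] using this.symm
  · simp [h]

end FreeProduct

section Counting

variable {G : Type*} [Group G]

/-- The words of length `n` over `S` with product `g`, as lists. -/
def wordsWithProd (S : Set G) (n : ℕ) (g : G) : Set (List G) :=
  {l | l.length = n ∧ (∀ s ∈ l, s ∈ S) ∧ l.prod = g}

theorem CL_eq_ncard (S : Set G) (n : ℕ) : CL S n = (wordsWithProd S n 1).ncard := by
  rw [CL, ← Nat.card_coe_set_eq]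
  refine Nat.card_congr (Equiv.ofBijective
    (fun w => ⟨List.ofFn w.1, by simp, by simpa [List.mem_ofFn] using w.2.1, w.2.2⟩) ⟨?_, ?_⟩)
  · intro v w h
    exact Subtype.ext (List.ofFn_injective (congrArg Subtype.val h))
  · rintro ⟨l, rfl, hS, hl⟩
    exact ⟨⟨l.get, fun i => hS _ (l.get_mem i), by simpa using hl⟩, Subtype.ext (by simp)⟩

theorem wordsWithProd_zero (S : Set G) (g : G) [Decidable (g = 1)] :
    (wordsWithProd S 0 g).ncard = if g = 1 then 1 else 0 := by
  split_ifs with h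
  · rw [Set.ncard_eq_one]
    refine ⟨[], Set.ext fun l => ?_⟩
    simp only [wordsWithProd, Set.mem_ofPred_eq, List.length_eq_zero_iff, Set.mem_singleton_iff]
    exact ⟨fun hl => hl.1, by rintro rfl; simp [h]⟩
  · convert Set.ncard_empty (List G)
    refine Set.eq_empty_iff_forall_notMem.2 fun l hl => h ?_
    rw [← hl.2.2, List.length_eq_zero_iff.1 hl.1, List.prod_nil]

theorem wordsWithProd_pair_succ (x y : G) (n : ℕ) (g : G) :
    wordsWithProd {x, y} (n + 1) g =
      List.cons x '' wordsWithProd {x, y} n (x⁻¹ * g) ∪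
        List.cons y '' wordsWithProd {x, y} n (y⁻¹ * g) := by
  ext l
  cases l with
  | nil => simp [wordsWithProd]
  | cons s l =>
    simp only [wordsWithProd, Set.mem_union, Set.mem_image, Set.mem_ofPred_eq, List.length_cons,
      List.mem_cons, forall_eq_or_imp, List.prod_cons, List.cons.injEq, Nat.add_right_cancel_iff]
    constructor
    · rintro ⟨hl, ⟨rfl | rfl, hS⟩, rfl⟩
      · exact Or.inl ⟨l, ⟨hl, hS, by simp⟩, rfl, rfl⟩
      · exact Or.inr ⟨l, ⟨hl, hS, by simp⟩, rfl, rfl⟩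
    · rintro (⟨l, ⟨hl, hS, hg⟩, rfl, rfl⟩ | ⟨l, ⟨hl, hS, hg⟩, rfl, rfl⟩)
      · exact ⟨hl, ⟨Or.inl rfl, hS⟩, by simp [hg]⟩
      · exact ⟨hl, ⟨Or.inr rfl, hS⟩, by simp [hg]⟩

theorem wordsWithProd_pair_finite (x y : G) (n : ℕ) (g : G) :
    (wordsWithProd {x, y} n g).Finite := by
  induction n generalizing g with
  | zero =>
    exact (Set.finite_singleton []).subset fun l hl => List.length_eq_zero_iff.1 hl.1
  | succ n ih =>
    rw [wordsWithProd_pair_succ]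
    exact ((ih _).image _).union ((ih _).image _)

theorem ncard_wordsWithProd_pair_succ {x y : G} (hxy : x ≠ y) (n : ℕ) (g : G) :
    (wordsWithProd {x, y} (n + 1) g).ncard =
      (wordsWithProd {x, y} n (x⁻¹ * g)).ncard + (wordsWithProd {x, y} n (y⁻¹ * g)).ncard := by
  rw [wordsWithProd_pair_succ, Set.ncard_union_eq _
    ((wordsWithProd_pair_finite x y n _).image _) ((wordsWithProd_pair_finite x y n _).image _),
    Set.ncard_image_of_injective _ List.cons_injective,
    Set.ncard_image_of_injective _ List.cons_injective]
  rw [Set.disjoint_left]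
  rintro _ ⟨l, -, rfl⟩ ⟨l', -, h⟩
  exact hxy (List.cons.inj h).1.symm

open PowerSeries in
/-- The Green's function equation determines the generating functions of the word counts. -/
theorem cogrowthSeries_pair_eq [DecidableEq G] {x y : G} (hxy : x ≠ y) (K : G → PowerSeries ℚ)
    (hK : ∀ g, K g = X * (K (x⁻¹ * g) + K (y⁻¹ * g)) + if g = 1 then 1 else 0) :
    cogrowthSeries {x, y} = K 1 := by
  have key : ∀ n g, coeff n (K g) = ((wordsWithProd {x, y} n g).ncard : ℚ) := by
    intro n
    induction n with
    | zero =>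
      intro g
      rw [hK, wordsWithProd_zero]
      split_ifs <;> simp
    | succ n ih =>
      intro g
      rw [hK, ncard_wordsWithProd_pair_succ hxy, map_add, coeff_succ_X_mul, map_add, ih, ih]
      split_ifs <;> simp [coeff_one]
  ext n
  rw [cogrowthSeries, coeff_mk, CL_eq_ncard, key]

end Counting

open PowerSeries in
/-- The first-passage series of the random walk on `ℤ/2 ⋆ ℤ/3`: `a` is the weight of the
syllable `x`, and `v` is the inverse of `1 - X * a`. -/
theorem exists_passage_series :
    ∃ a v : PowerSeries ℚ, (1 - X * a) * v = 1 ∧ a = X * (1 + X ^ 2 * v ^ 2 * a) := by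
  let f : Polynomial (PowerSeries ℚ) :=
    Polynomial.X ^ 3 + Polynomial.C (X ^ 2 - 1) * Polynomial.X ^ 2
      - Polynomial.C (X ^ 3) * Polynomial.X + Polynomial.C (X ^ 3)
  have hf : f.Monic := by
    unfold f
    monicity!
  have hX : Ideal.Quotient.mk (Ideal.span {(X : PowerSeries ℚ)}) X = 0 :=
    Ideal.Quotient.eq_zero_iff_mem.2 (Ideal.mem_span_singleton_self _)
  obtain ⟨u, hu, hu1⟩ := HenselianRing.is_henselian (I := Ideal.span {(X : PowerSeries ℚ)}) f hf 1
    (by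
      rw [Ideal.mem_span_singleton]
      exact ⟨X, by simp [f]; ring⟩)
    (by
      have hf' : f.derivative.eval 1 = 1 + X * (2 * X - X ^ 2) := by
        simp [f, Polynomial.derivative_pow]
        ring
      rw [hf', map_add, map_mul, hX, zero_mul, add_zero, map_one]
      exact isUnit_one)
  obtain ⟨d, hd⟩ := Ideal.mem_span_singleton.1 hu1
  have hu' : u ^ 3 + (X ^ 2 - 1) * u ^ 2 - X ^ 3 * u + X ^ 3 = 0 := by
    simpa [f] using hu
  have hunit : IsUnit u := by
    rw [isUnit_iff_constantCoeff, sub_eq_iff_eq_add.1 hd]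
    simp
  obtain ⟨v, hv⟩ := hunit.exists_right_inv
  refine ⟨-d, v, by linear_combination hv + v * (-hd), ?_⟩
  refine mul_left_cancel₀ (X_ne_zero (R := ℚ)) ?_
  linear_combination -v ^ 2 * hu' + (u * v + 1) * (u - 1 + X ^ 2) * hv + (1 - X ^ 3 * v ^ 2) * hd

/-- Elimination of the first-passage series from the equation of the Green's function. -/
theorem cubic_of_passage_equations {R : Type*} [CommRing R] [IsDomain R] {t a v F : R}
    (hv : (1 - t * a) * v = 1) (ha : a = t * (1 + t ^ 2 * v ^ 2 * a))
    (hF : (1 - t * a - t * (t ^ 2 * v ^ 2)) * F = 1) :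
    ((t - 1) ^ 3 + t ^ 3) * ((t + 1) ^ 3 - t ^ 3) * F ^ 3
      + (t ^ 5 - t ^ 4 + t ^ 3 + 2 * t ^ 2 - 1) * F ^ 2 + (t ^ 3 - t ^ 2 + 1) * F + 1 = 0 := by
  obtain ⟨u, hu⟩ : ∃ u, u = 1 - t * a := ⟨_, rfl⟩
  rw [← hu] at hv hF
  have hroot : u ^ 2 * (u - 1 + t ^ 2) + t ^ 3 * (1 - u) = 0 := by
    linear_combination -t * u ^ 2 * ha - t ^ 4 * a * (u * v + 1) * hv
      + (u ^ 2 - t ^ 3) * hu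
  have hFu : F * (u ^ 3 - t ^ 3) = u ^ 2 := by
    linear_combination u ^ 2 * hF + F * t ^ 3 * (u * v + 1) * hv
  have hne : u ^ 3 - t ^ 3 ≠ 0 := fun h => by
    rw [h, mul_zero] at hFu
    have : u = 0 := pow_eq_zero_iff two_ne_zero |>.1 hFu.symm
    simp [this] at hv
  refine (mul_eq_zero.1 ?_).resolve_right (pow_ne_zero 3 hne)
  linear_combination
    (-t ^ 6 - u * t ^ 6 + 3 * u ^ 3 * t ^ 3 + u ^ 3 * t ^ 5 + u ^ 4 - 2 * u ^ 4 * t ^ 2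
      + 3 * u ^ 4 * t ^ 3 + u ^ 4 * t ^ 4 + 2 * u ^ 5 - 2 * u ^ 5 * t ^ 2 + u ^ 5 * t ^ 3
      + u ^ 6) * hroot
    + (((t - 1) ^ 3 + t ^ 3) * ((t + 1) ^ 3 - t ^ 3)
        * (F ^ 2 * (u ^ 3 - t ^ 3) ^ 2 + F * (u ^ 3 - t ^ 3) * u ^ 2 + u ^ 4)
      + (t ^ 5 - t ^ 4 + t ^ 3 + 2 * t ^ 2 - 1) * (u ^ 3 - t ^ 3)
        * (F * (u ^ 3 - t ^ 3) + u ^ 2)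
      + (t ^ 3 - t ^ 2 + 1) * (u ^ 3 - t ^ 3) ^ 2) * hFu

/-- For `G = ℤ/2ℤ ⋆ ℤ/3ℤ ≅ PSL₂(ℤ)` with `S = {x, y}` (`x, y`
the generators of the two factors), the cogrowth series `F` satisfies
`((t−1)³+t³)((t+1)³−t³)F³ + (t⁵−t⁴+t³+2t²−1)F² + (t³−t²+1)F + 1 = 0`. -/
theorem cogrowth_series_PSL2Z_cubic
    (x y : Monoid.Coprod (Multiplicative (ZMod 2)) (Multiplicative (ZMod 3)))
    (hx : x = Monoid.Coprod.inl (Multiplicative.ofAdd (1 : ZMod 2)))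
    (hy : y = Monoid.Coprod.inr (Multiplicative.ofAdd (1 : ZMod 3)))
    (F : PowerSeries ℚ) (hF : F = cogrowthSeries {x, y}) :
    ((PowerSeries.X - 1) ^ 3 + PowerSeries.X ^ 3)
        * ((PowerSeries.X + 1) ^ 3 - PowerSeries.X ^ 3) * F ^ 3
      + (PowerSeries.X ^ 5 - PowerSeries.X ^ 4 + PowerSeries.X ^ 3
          + 2 * PowerSeries.X ^ 2 - 1) * F ^ 2
      + (PowerSeries.X ^ 3 - PowerSeries.X ^ 2 + 1) * F + 1 = 0 := by
  classical
  obtain ⟨nf, hnx, hny, hn1⟩ := exists_normalForm x y hx hy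
  obtain ⟨a, v, hv, ha⟩ := exists_passage_series
  have hxy : x ≠ y := fun h => by
    have := congrArg Monoid.Coprod.fst (hx ▸ hy ▸ h)
    rw [Monoid.Coprod.fst_apply_inl, Monoid.Coprod.fst_apply_inr] at this
    exact absurd this (by decide)
  obtain ⟨E, hE⟩ : ∃ E : PowerSeries ℚ,
      (1 - PowerSeries.X * a - PowerSeries.X * (PowerSeries.X ^ 2 * v ^ 2)) * E = 1 := by
    refine IsUnit.exists_right_inv (PowerSeries.isUnit_iff_constantCoeff.2 ?_)
    simp
  have hFE : F = E := by
    rw [hF, cogrowthSeries_pair_eq hxy fun g =>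
      E * ReducedTail.weight a (PowerSeries.X * v) (PowerSeries.X ^ 2 * v ^ 2) (nf g)]
    · rw [(hn1 1).2 rfl]
      simp [ReducedTail.weight, ReducedTail.weightTail]
    · intro g
      rw [hnx, hny]
      split_ifs with h
      · rw [(hn1 g).2 h]
        simp only [ReducedTail.weight, ReducedTail.weightTail, ReducedTail.mulX,
          ReducedTail.mulY, cond_true, cond_false, Bool.not_false]
        linear_combination hE
      · rw [ReducedTail.weight_eq (t := PowerSeries.X) (by linear_combination ha)
          (by linear_combination PowerSeries.X * hv)
          (by linear_combination PowerSeries.X ^ 2 * v * hv) (mt (hn1 g).1 h)]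
        ring
  subst hFE
  exact cubic_of_passage_equations hv ha hE
end
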